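/- Let G be a group containing a free subgroup of finite index. Then for every 2-cocycle μ : G × G → ℂˣ (for the trivial G-action) that is torsion modulo coboundaries, there exist an integer r ≥ 1, a function ρ : G → GL_r(ℂ), and a function c : G → ℂˣ such that ρ(g)·ρ(h) = (μ(g,h)·c(g)·c(h)·c(gh)⁻¹) • ρ(gh) for all g, h ∈ G; that is, up to a coboundary, μ is the obstruction cocycle of a projective representation of G. -/

import Mathlib

/-- The central extension of `G` by `A` attached to a map `μ : G → G → A`, as a type. -/
@[ext]
structure CocycleExtension {G A : Type*} (μ : G → G → A) where
  /-- The central coordinate. -/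
  left : A
  /-- The projection to `G`. -/
  right : G

namespace CocycleExtension

variable {G A : Type*} [Group G] [CommGroup A] {μ : G → G → A}

theorem cocycle_one_left (hμ : ∀ g h k : G, μ h k * μ g (h * k) = μ g h * μ (g * h) k) (g : G) :
    μ 1 g = μ 1 1 := by
  simpa using hμ 1 1 g

theorem cocycle_one_right (hμ : ∀ g h k : G, μ h k * μ g (h * k) = μ g h * μ (g * h) k) (g : G) :
    μ g 1 = μ 1 1 := by
  simpa using (hμ g 1 1).symm

/-- The group structure on the central extension attached to a 2-cocycle. -/
abbrev group (hμ : ∀ g h k : G, μ h k * μ g (h * k) = μ g h * μ (g * h) k) :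
    Group (CocycleExtension μ) :=
  letI : Mul (CocycleExtension μ) := ⟨fun x y ↦ ⟨x.1 * y.1 * μ x.2 y.2, x.2 * y.2⟩⟩
  letI : One (CocycleExtension μ) := ⟨⟨(μ 1 1)⁻¹, 1⟩⟩
  letI : Inv (CocycleExtension μ) :=
    ⟨fun x ↦ ⟨x.1⁻¹ * (μ x.2⁻¹ x.2)⁻¹ * (μ 1 1)⁻¹, x.2⁻¹⟩⟩
  Group.ofLeftAxioms
    (fun x y z ↦ by
      refine CocycleExtension.ext ?_ (mul_assoc x.2 y.2 z.2)
      change x.1 * y.1 * μ x.2 y.2 * z.1 * μ (x.2 * y.2) z.2 =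
        x.1 * (y.1 * z.1 * μ y.2 z.2) * μ x.2 (y.2 * z.2)
      calc _ = x.1 * y.1 * z.1 * (μ x.2 y.2 * μ (x.2 * y.2) z.2) := by
            simp only [mul_comm, mul_left_comm]
        _ = x.1 * y.1 * z.1 * (μ y.2 z.2 * μ x.2 (y.2 * z.2)) := by rw [hμ]
        _ = _ := by simp only [mul_comm, mul_left_comm])
    (fun x ↦ by
      refine CocycleExtension.ext ?_ (one_mul x.2)
      change (μ 1 1)⁻¹ * x.1 * μ 1 x.2 = x.1
      rw [cocycle_one_left hμ x.2, mul_right_comm, inv_mul_cancel, one_mul])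
    (fun x ↦ by
      refine CocycleExtension.ext ?_ (inv_mul_cancel x.2)
      change x.1⁻¹ * (μ x.2⁻¹ x.2)⁻¹ * (μ 1 1)⁻¹ * x.1 * μ x.2⁻¹ x.2 = (μ 1 1)⁻¹
      rw [mul_assoc, mul_comm, ← mul_assoc, ← mul_assoc,
        show x.1 * μ x.2⁻¹ x.2 * x.1⁻¹ = μ x.2⁻¹ x.2 by rw [mul_comm, inv_mul_cancel_left],
        mul_inv_cancel, one_mul])

end CocycleExtension

/-- Every 2-cocycle on a free group with values in a trivial module is a coboundary. -/
theorem IsFreeGroup.exists_coboundary {F A : Type*} [Group F] [IsFreeGroup F] [CommGroup A]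
    (μ : F → F → A) (hμ : ∀ g h k : F, μ h k * μ g (h * k) = μ g h * μ (g * h) k) :
    ∃ f : F → A, ∀ p q : F, f p * f q = μ p q * f (p * q) := by
  let := CocycleExtension.group hμ
  let π : CocycleExtension μ →* F :=
    { toFun := fun x ↦ x.right, map_one' := rfl, map_mul' := fun _ _ ↦ rfl }
  let s : F →* CocycleExtension μ := IsFreeGroup.lift fun x ↦ ⟨1, IsFreeGroup.of x⟩
  have hs : π.comp s = MonoidHom.id F := by
    refine IsFreeGroup.ext_hom fun x ↦ ?_
    rw [MonoidHom.comp_apply, IsFreeGroup.lift_of]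
    rfl
  have hright (p : F) : (s p).right = p := DFunLike.congr_fun hs p
  refine ⟨fun p ↦ (s p).left⁻¹, fun p q ↦ ?_⟩
  have hleft : (s (p * q)).left = (s p).left * (s q).left * μ (s p).right (s q).right :=
    congrArg CocycleExtension.left (map_mul s p q)
  rw [hright, hright] at hleft
  beta_reduce
  rw [hleft, mul_inv_rev, mul_inv_cancel_left, mul_inv]

section TwistedInduction

variable {G K : Type*} [Group G] [Field K]

/-- The space of functions on `G` underlying the projective representation with cocycle `μ`
induced from the twisted character `f` of `P`. -/
def twistedInd (μ : G → G → Kˣ) (P : Subgroup G) (f : P → Kˣ) : Submodule K (G → K) where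
  carrier := {φ | ∀ (p : P) (g : G), φ (p * g) = (f p * (μ p g)⁻¹ : Kˣ) * φ g}
  add_mem' hφ hψ p g := by simp only [Pi.add_apply, hφ p g, hψ p g, mul_add]
  zero_mem' p g := by simp
  smul_mem' a φ hφ p g := by simp only [Pi.smul_apply, hφ p g, smul_eq_mul, mul_left_comm]

variable {μ : G → G → Kˣ} {P : Subgroup G} {f : P → Kˣ}

theorem finiteDimensional_twistedInd [P.FiniteIndex] :
    FiniteDimensional K (twistedInd μ P f) := by
  let res : twistedInd μ P f →ₗ[K] (G ⧸ P → K) :=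
    { toFun := fun φ x ↦ φ.1 (x.out)⁻¹, map_add' := fun _ _ ↦ rfl, map_smul' := fun _ _ ↦ rfl }
  refine Module.Finite.of_injective res ((injective_iff_map_eq_zero res).2 fun φ hφ ↦ ?_)
  ext g
  obtain ⟨p, hp⟩ := QuotientGroup.mk_out_eq_mul P g⁻¹
  have h : φ.1 ((g⁻¹ * p)⁻¹) = 0 := by
    rw [← hp]
    exact congrFun hφ (g⁻¹ : G)
  have h' := φ.2 p⁻¹ g
  rw [mul_inv_rev, inv_inv] at h
  rw [Subgroup.coe_inv, h] at h'
  exact (mul_eq_zero.1 h'.symm).resolve_left (Units.ne_zero _)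

theorem nontrivial_twistedInd
    (hf : ∀ p q : P, f p * f q = μ p q * f (p * q)) : Nontrivial (twistedInd μ P f) := by
  classical
  let φ : G → K := fun g ↦ if hg : g ∈ P then (f ⟨g, hg⟩ : K) else 0
  have hφ : φ ∈ twistedInd μ P f := by
    intro p g
    by_cases hg : g ∈ P
    · have h : f (p * ⟨g, hg⟩) = f p * (μ p g)⁻¹ * f ⟨g, hg⟩ := by
        rw [mul_right_comm, hf, mul_right_comm, mul_inv_cancel, one_mul]
      simp only [φ, dif_pos hg, dif_pos (P.mul_mem p.2 hg), ← Units.val_mul, ← h]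
      rfl
    · have h : (p : G) * g ∉ P := fun h ↦ hg ((P.mul_mem_cancel_left p.2).1 h)
      simp only [φ, dif_neg hg, dif_neg h, mul_zero]
  refine ⟨⟨⟨φ, hφ⟩, 0, fun h ↦ ?_⟩⟩
  have h1 : φ 1 = 0 := congrFun (congrArg Subtype.val h) 1
  simp only [φ, dif_pos P.one_mem] at h1
  exact Units.ne_zero _ h1

/-- Twisted right translation on the induced space. -/
def twistedTranslation (hμ : ∀ g h k : G, μ h k * μ g (h * k) = μ g h * μ (g * h) k) (k : G) :
    Module.End K (twistedInd μ P f) where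
  toFun φ := ⟨fun g ↦ μ g k * φ.1 (g * k), fun p g ↦ by
    have h : μ (p * g) k * (f p * (μ p (g * k))⁻¹) = f p * (μ p g)⁻¹ * μ g k := by
      calc _ = f p * (μ p g)⁻¹ * ((μ p g * μ (p * g) k) * (μ p (g * k))⁻¹) := by
            simp only [mul_assoc, inv_mul_cancel_left]
            exact mul_left_comm _ _ _
        _ = _ := by rw [← hμ, mul_inv_cancel_right]
    beta_reduce
    rw [mul_assoc, φ.2 p (g * k), ← mul_assoc, ← mul_assoc, ← Units.val_mul, ← Units.val_mul, h]⟩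
  map_add' φ ψ := by ext g; exact mul_add _ _ _
  map_smul' a φ := by ext g; exact mul_left_comm _ _ _

theorem twistedTranslation_mul (hμ : ∀ g h k : G, μ h k * μ g (h * k) = μ g h * μ (g * h) k)
    (k l : G) : (twistedTranslation hμ k * twistedTranslation hμ l : Module.End K (twistedInd μ P f))
      = (μ k l : K) • twistedTranslation hμ (k * l) := by
  ext φ g
  change (μ g k : K) * (μ (g * k) l * φ.1 (g * k * l)) = μ k l * (μ g (k * l) * φ.1 (g * (k * l)))
  rw [← mul_assoc, ← mul_assoc, ← Units.val_mul, ← Units.val_mul, hμ, mul_assoc g]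

theorem twistedTranslation_one (hμ : ∀ g h k : G, μ h k * μ g (h * k) = μ g h * μ (g * h) k) :
    (twistedTranslation hμ 1 : Module.End K (twistedInd μ P f)) = (μ 1 1 : K) • 1 := by
  ext φ g
  change (μ g 1 : K) * φ.1 (g * 1) = μ 1 1 * φ.1 g
  rw [CocycleExtension.cocycle_one_right hμ, mul_one]

end TwistedInduction


/-- If `G` contains a free subgroup of finite index, then every `ℂˣ`-valued
2-cocycle on `G` (for the trivial action) that is torsion modulo coboundaries is,
up to a coboundary, the obstruction cocycle of a projective representation of `G`. -/
theorem torsion_cocycle_from_projective_rep_of_almost_free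
    (G : Type) [Group G]
    (hG : ∃ P : Subgroup G, IsFreeGroup P ∧ P.FiniteIndex)
    (μ : G → G → ℂˣ)
    (hcocycle : ∀ g h k : G, μ h k * μ g (h * k) = μ g h * μ (g * h) k)
    (htorsion : ∃ n : ℕ, 0 < n ∧ ∃ c : G → ℂˣ,
      ∀ g h : G, (μ g h) ^ n = c g * c h * (c (g * h))⁻¹) :
    ∃ (r : ℕ), 1 ≤ r ∧ ∃ (ρ : G → GL (Fin r) ℂ) (c : G → ℂˣ),
      ∀ g h : G, ((ρ g : Matrix (Fin r) (Fin r) ℂ) * (ρ h : Matrix (Fin r) (Fin r) ℂ)) =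
        ((μ g h * c g * c h * (c (g * h))⁻¹ : ℂˣ) : ℂ) •
          (↑(ρ (g * h)) : Matrix (Fin r) (Fin r) ℂ) := by
  obtain ⟨P, _, _⟩ := hG
  obtain ⟨f, hf⟩ := IsFreeGroup.exists_coboundary (fun p q : P ↦ μ p q)
    fun g h k ↦ hcocycle g h k
  have := finiteDimensional_twistedInd (μ := μ) (P := P) (f := f)
  have := nontrivial_twistedInd hf
  let b := Module.finBasis ℂ (twistedInd μ P f)
  let M : G → Matrix _ _ ℂ := fun g ↦ LinearMap.toMatrixAlgEquiv b (twistedTranslation hcocycle g)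
  have hM (g h : G) : M g * M h = (μ g h : ℂ) • M (g * h) := by
    simp only [M, ← map_mul, twistedTranslation_mul, map_smul]
  have hM1 : M 1 = (μ 1 1 : ℂ) • 1 := by
    simp only [M, twistedTranslation_one, map_smul, map_one]
  have hunit (g : G) : IsUnit (M g) := by
    refine (Matrix.isUnit_iff_isUnit_det _).2 (isUnit_of_mul_isUnit_left (y := (M g⁻¹).det) ?_)
    rw [← Matrix.det_mul, hM, mul_inv_cancel, hM1, smul_smul, Matrix.det_smul, Matrix.det_one,
      mul_one, ← Units.val_mul, ← Units.val_pow_eq_pow_val]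
    exact Units.isUnit _
  refine ⟨_, Module.finrank_pos (R := ℂ) (M := twistedInd μ P f), fun g ↦ (hunit g).unit,
    fun _ ↦ 1, fun g h ↦ ?_⟩
  simpa using hM g h
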